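/- arXiv:0809.0457 — 2 statements merged into one kernel-verified Lean document; each statement's English description precedes it below -/
import Mathlib

section
/- Let G be a group acting by isometries on a proper CAT(0) space X. Then either G has a global fixed point in ∂X, or every filtering family of nonempty closed convex G-invariant subsets of X has nonempty intersection. -/
open Metric Set Filter

universe u v

variable {X : Type u}

/-- An affinely parametrised geodesic segment from `x` to `y`, defined on `[0,1]`. -/
def IsGeodesicSeg [MetricSpace X] (x y : X) (γ : ℝ → X) : Prop :=
  γ 0 = x ∧ γ 1 = y ∧
    ∀ s ∈ Set.Icc (0:ℝ) 1, ∀ t ∈ Set.Icc (0:ℝ) 1, dist (γ s) (γ t) = |s - t| * dist x y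

/-- A CAT(0) space: a geodesic metric space in which every geodesic triangle is at least as
thin as its Euclidean comparison triangle, expressed via the standard comparison
(convexity) inequality along geodesics. -/
class CAT0Space (X : Type u) [MetricSpace X] : Prop where
  exists_geodesic : ∀ x y : X, ∃ γ : ℝ → X, IsGeodesicSeg x y γ
  comparison : ∀ (p x y : X) (γ : ℝ → X), IsGeodesicSeg x y γ → ∀ t ∈ Set.Icc (0:ℝ) 1,
    dist p (γ t) ^ 2 ≤ (1 - t) * dist p x ^ 2 + t * dist p y ^ 2 - t * (1 - t) * dist x y ^ 2

/-- A subset is (geodesically) convex if it contains every geodesic segment between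
any two of its points. -/
def GeoConvex [MetricSpace X] (C : Set X) : Prop :=
  ∀ x ∈ C, ∀ y ∈ C, ∀ γ : ℝ → X, IsGeodesicSeg x y γ → ∀ t ∈ Set.Icc (0:ℝ) 1, γ t ∈ C

/-- Every geodesic segment of positive length extends to a locally isometric embedding
of the whole real line. -/
def GeodesicallyComplete (X : Type u) [MetricSpace X] : Prop :=
  ∀ x y : X, x ≠ y → ∀ γ : ℝ → X, IsGeodesicSeg x y γ →
    ∃ ℓ : ℝ → X,
      (∀ t : ℝ, ∃ ε > (0:ℝ), ∀ s₁ ∈ Set.Ioo (t - ε) (t + ε), ∀ s₂ ∈ Set.Ioo (t - ε) (t + ε),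
        dist (ℓ s₁) (ℓ s₂) = |s₁ - s₂|) ∧
      ∀ t ∈ Set.Icc (0:ℝ) 1, ℓ (t * dist x y) = γ t

/-- A (unit speed) geodesic ray, parametrised by `[0,∞)`. -/
structure GeodesicRay (X : Type u) [MetricSpace X] where
  toFun : ℝ → X
  isom : ∀ s, 0 ≤ s → ∀ t, 0 ≤ t → dist (toFun s) (toFun t) = |s - t|

/-- Two rays are asymptotic if they remain at bounded distance. -/
def GeodesicRay.Asymp [MetricSpace X] (ρ σ : GeodesicRay X) : Prop :=
  ∃ C : ℝ, ∀ t, 0 ≤ t → dist (ρ.toFun t) (σ.toFun t) ≤ C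

theorem GeodesicRay.asymp_equivalence (X : Type u) [MetricSpace X] :
    Equivalence (GeodesicRay.Asymp (X := X)) where
  refl ρ := ⟨0, fun t _ => by simp⟩
  symm := fun {ρ σ} ⟨C, hC⟩ => ⟨C, fun t ht => by rw [dist_comm]; exact hC t ht⟩
  trans := fun {ρ σ τ} ⟨C₁, h₁⟩ ⟨C₂, h₂⟩ =>
    ⟨C₁ + C₂, fun t ht => (dist_triangle (ρ.toFun t) (σ.toFun t) (τ.toFun t)).trans
      (add_le_add (h₁ t ht) (h₂ t ht))⟩

instance GeodesicRay.setoid (X : Type u) [MetricSpace X] : Setoid (GeodesicRay X) :=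
  ⟨GeodesicRay.Asymp, GeodesicRay.asymp_equivalence X⟩

/-- The boundary at infinity: asymptote classes of geodesic rays. -/
def Boundary (X : Type u) [MetricSpace X] : Type u := Quotient (GeodesicRay.setoid X)

/-- The boundary point determined by a ray. -/
def GeodesicRay.cls [MetricSpace X] (ρ : GeodesicRay X) : Boundary X := Quotient.mk _ ρ

/-- The boundary at infinity of a subset `Y ⊆ X`: classes of rays staying within
bounded distance of `Y`. -/
def boundarySet [MetricSpace X] (Y : Set X) : Set (Boundary X) :=
  {ξ | ∃ ρ : GeodesicRay X, ρ.cls = ξ ∧ ∃ C : ℝ, ∀ t, 0 ≤ t → ∃ y ∈ Y, dist (ρ.toFun t) y ≤ C}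

/-- Composition of a ray with an isometric map. -/
def GeodesicRay.comp [MetricSpace X] (f : X → X) (hf : Isometry f) (ρ : GeodesicRay X) :
    GeodesicRay X :=
  ⟨fun t => f (ρ.toFun t), fun s hs t ht => by simpa [hf.dist_eq] using ρ.isom s hs t ht⟩

/-- The induced map of an isometric map on the boundary at infinity. -/
def Boundary.map [MetricSpace X] (f : X → X) (hf : Isometry f) : Boundary X → Boundary X :=
  Quotient.map (GeodesicRay.comp f hf)
    (fun ρ σ h => by
      obtain ⟨C, hC⟩ := h
      exact ⟨C, fun t ht => by simpa [GeodesicRay.comp, hf.dist_eq] using hC t ht⟩)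

/-- The Euclidean comparison angle at `p` of the points `x, y`. -/
noncomputable def cmpAngle [MetricSpace X] (p x y : X) : ℝ :=
  Real.arccos ((dist p x ^ 2 + dist p y ^ 2 - dist x y ^ 2) / (2 * dist p x * dist p y))

/-- The Alexandrov angle between two geodesic rays issuing from the same point
(in a CAT(0) space, the comparison angles are monotone, so the limit defining the
Alexandrov angle is the infimum of comparison angles). -/
noncomputable def alexAngleRays [MetricSpace X] (ρ σ : ℝ → X) : ℝ :=
  sInf {a | ∃ s, 0 < s ∧ ∃ t, 0 < t ∧ a = cmpAngle (ρ 0) (ρ s) (σ t)}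

/-- The Alexandrov angle between two geodesic segments (parametrised on `[0,1]`)
issuing from the same point. -/
noncomputable def alexAngleSegs [MetricSpace X] (γ δ : ℝ → X) : ℝ :=
  sInf {a | ∃ s ∈ Set.Ioc (0:ℝ) 1, ∃ t ∈ Set.Ioc (0:ℝ) 1, a = cmpAngle (γ 0) (γ s) (δ t)}

/-- The Tits angle between two boundary points: the supremum over basepoints of the
Alexandrov angle between the rays issuing from that basepoint representing them. -/
noncomputable def titsAngle [MetricSpace X] (ξ η : Boundary X) : ℝ :=
  sSup {a | ∃ ρ σ : GeodesicRay X, ρ.toFun 0 = σ.toFun 0 ∧ ρ.cls = ξ ∧ σ.cls = η ∧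
    a = alexAngleRays ρ.toFun σ.toFun}

/-- The circumradius of `Z` within `Y`, with respect to the distance function `d`. -/
noncomputable def circumradiusIn {B : Type v} (d : B → B → ℝ) (Y Z : Set B) : ℝ :=
  sInf ((fun y => sSup ((fun z => d y z) '' Z)) '' Y)

/-- The topology of the Tits boundary, generated by the balls of the Tits angle metric. -/
instance boundaryTopology (X : Type u) [MetricSpace X] : TopologicalSpace (Boundary X) :=
  TopologicalSpace.generateFrom
    {U | ∃ (ξ : Boundary X) (r : ℝ), U = {η | titsAngle ξ η < r}}

/-- Lebesgue covering dimension of a subset `K` is at most `n`: every open cover of `K`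
admits an open refinement covering `K` of multiplicity at most `n+1` on `K`. -/
def CovDimSubsetLE {B : Type v} [TopologicalSpace B] (K : Set B) (n : ℕ) : Prop :=
  ∀ 𝒰 : Set (Set B), (∀ U ∈ 𝒰, IsOpen U) → K ⊆ ⋃₀ 𝒰 →
    ∃ 𝒱 : Set (Set B), (∀ V ∈ 𝒱, IsOpen V) ∧ K ⊆ ⋃₀ 𝒱 ∧
      (∀ V ∈ 𝒱, ∃ U ∈ 𝒰, V ⊆ U) ∧
      ∀ x ∈ K, {V | V ∈ 𝒱 ∧ x ∈ V}.Finite ∧ {V | V ∈ 𝒱 ∧ x ∈ V}.ncard ≤ n + 1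

/-- The Tits boundary is finite-dimensional: the topological dimension of compact
subsets of the Tits boundary is bounded. -/
def FiniteDimTitsBoundary (X : Type u) [MetricSpace X] : Prop :=
  ∃ n : ℕ, ∀ K : Set (Boundary X), IsCompact K → CovDimSubsetLE K n

/-- The topology of uniform convergence on compacta (compact-open topology) on the
isometry group of `X`. -/
instance isomEquivTopology (X : Type u) [MetricSpace X] : TopologicalSpace (X ≃ᵢ X) :=
  TopologicalSpace.induced (fun g : X ≃ᵢ X => (⟨⇑g, g.continuous⟩ : C(X, X)))
    ContinuousMap.compactOpen

/-- A subgroup of the isometry group acts minimally: there is no nonempty proper closed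
convex invariant subset. -/
def MinimalSubgroupAction [MetricSpace X] (G : Subgroup (X ≃ᵢ X)) : Prop :=
  ∀ C : Set X, C.Nonempty → IsClosed C → GeoConvex C →
    (∀ g ∈ G, ∀ x ∈ C, g x ∈ C) → C = Set.univ

section SMulNotions
variable {G : Type v} [Group G] [MulAction G X] [MetricSpace X]

/-- The translation length of `g`. -/
noncomputable def transLength (g : G) : ℝ := sInf (Set.range fun x : X => dist (g • x) x)

/-- `g` acts as an elliptic isometry: it fixes a point. -/
def IsEllipticSMul (g : G) : Prop := ∃ x : X, g • x = x

/-- `g` acts as a hyperbolic isometry: its translation length is positive and attained. -/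
def IsHyperbolicSMul (g : G) : Prop :=
  ∃ x : X, dist (g • x) x = transLength (X := X) g ∧ 0 < dist (g • x) x

end SMulNotions

/-- The Busemann function associated with a geodesic ray, based at `ρ 0`
(the limit exists, hence agrees with the `limsup`). -/
noncomputable def busemann [MetricSpace X] (ρ : GeodesicRay X) (y : X) : ℝ :=
  Filter.limsup (fun t : ℝ => dist (ρ.toFun t) y - dist (ρ.toFun t) (ρ.toFun 0)) Filter.atTop

/-- Convergence of a sequence to a boundary point in the cône topology (in a CAT(0)
space): the sequence escapes to infinity and the geodesics from the basepoint `p` to the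
points of the sequence converge pointwise to the ray from `p` representing `η`. -/
def SeqTendstoBoundary [MetricSpace X] (p : X) (u : ℕ → X) (η : Boundary X) : Prop :=
  Filter.Tendsto (fun n => dist p (u n)) Filter.atTop Filter.atTop ∧
  ∃ σ : GeodesicRay X, σ.toFun 0 = p ∧ σ.cls = η ∧
    ∀ γ : ℕ → ℝ → X, (∀ n, IsGeodesicSeg p (u n) (γ n)) →
      ∀ t, 0 ≤ t →
        Filter.Tendsto (fun n => γ n (t / dist p (u n))) Filter.atTop (nhds (σ.toFun t))

/-- The closed convex hull of a subset. -/
def closedGeoConvexHull [MetricSpace X] (S : Set X) : Set X :=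
  ⋂₀ {C : Set X | IsClosed C ∧ GeoConvex C ∧ S ⊆ C}

/-- A real function is convex if its restriction to every geodesic is convex. -/
def ConvexFun [MetricSpace X] (f : X → ℝ) : Prop :=
  ∀ (x y : X) (γ : ℝ → X), IsGeodesicSeg x y γ →
    ∀ s ∈ Set.Icc (0:ℝ) 1, ∀ t ∈ Set.Icc (0:ℝ) 1, ∀ a b : ℝ, 0 ≤ a → 0 ≤ b → a + b = 1 →
      f (γ (a * s + b * t)) ≤ a * f (γ s) + b * f (γ t)

/-- `X` is boundary-minimal: no proper closed convex subset has full boundary. -/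
def BoundaryMinimal (X : Type u) [MetricSpace X] : Prop :=
  ∀ Y : Set X, IsClosed Y → GeoConvex Y → boundarySet Y = boundarySet (Set.univ : Set X) →
    Y = Set.univ

/-- A geodesic segment with respect to an abstract distance function `d`. -/
def IsGeodesicSegD {B : Type v} (d : B → B → ℝ) (x y : B) (γ : ℝ → B) : Prop :=
  γ 0 = x ∧ γ 1 = y ∧
    ∀ s ∈ Set.Icc (0:ℝ) 1, ∀ t ∈ Set.Icc (0:ℝ) 1, d (γ s) (γ t) = |s - t| * d x y

/-- Convexity with respect to an abstract distance function `d`. -/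
def DConvex {B : Type v} (d : B → B → ℝ) (A : Set B) : Prop :=
  ∀ x ∈ A, ∀ y ∈ A, ∀ γ : ℝ → B, IsGeodesicSegD d x y γ → ∀ t ∈ Set.Icc (0:ℝ) 1, γ t ∈ A

/-- `X` is irreducible: it admits no isometric splitting as an (ℓ²-)product with both
factors containing more than one point. -/
def IrreducibleCAT0 (X : Type u) [MetricSpace X] : Prop :=
  ¬ ∃ (A : Type u) (B : Type u) (_ : MetricSpace A) (_ : MetricSpace B)
      (_ : X ≃ᵢ WithLp 2 (A × B)), Nontrivial A ∧ Nontrivial B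

/-- The forward ray of a geodesic line. -/
def GeodesicRay.ofLineFwd [MetricSpace X] (ℓ : ℝ → X)
    (h : ∀ s t : ℝ, dist (ℓ s) (ℓ t) = |s - t|) : GeodesicRay X :=
  ⟨ℓ, fun s _ t _ => h s t⟩

/-- The backward ray of a geodesic line. -/
def GeodesicRay.ofLineBwd [MetricSpace X] (ℓ : ℝ → X)
    (h : ∀ s t : ℝ, dist (ℓ s) (ℓ t) = |s - t|) : GeodesicRay X :=
  ⟨fun t => ℓ (-t), fun s _ t _ => by
    rw [h (-s) (-t), show (-s) - (-t) = -(s - t) by ring, abs_neg]⟩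

/-- Two boundary points are opposite if they are the two endpoints of a geodesic line. -/
def OppositeBd [MetricSpace X] (ξ η : Boundary X) : Prop :=
  ∃ (ℓ : ℝ → X) (h : ∀ s t : ℝ, dist (ℓ s) (ℓ t) = |s - t|),
    (GeodesicRay.ofLineBwd ℓ h).cls = ξ ∧ (GeodesicRay.ofLineFwd ℓ h).cls = η

/-- An isometry is parabolic if its displacement function does not attain its infimum. -/
def IsParabolicIsom [MetricSpace X] (g : X ≃ᵢ X) : Prop :=
  ¬ ∃ x : X, dist (g x) x = sInf (Set.range fun y : X => dist (g y) y)

/-- The fixed-point set of an isometry in the boundary at infinity. -/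
def boundaryFixedSet [MetricSpace X] (g : X ≃ᵢ X) : Set (Boundary X) :=
  {ξ | Boundary.map (⇑g) g.isometry ξ = ξ}


namespace IsGeodesicSeg

variable [MetricSpace X]

theorem reverse {x y : X} {γ : ℝ → X} (h : IsGeodesicSeg x y γ) :
    IsGeodesicSeg y x (fun t => γ (1 - t)) := by
  refine ⟨by simpa using h.2.1, by simpa using h.1, fun s hs t ht => ?_⟩
  rw [h.2.2 _ ⟨by linarith [hs.2], by linarith [hs.1]⟩ _ ⟨by linarith [ht.2], by linarith [ht.1]⟩,
    dist_comm y x, show 1 - s - (1 - t) = -(s - t) by ring, abs_neg]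

theorem comp_isometry {x y : X} {γ : ℝ → X} (h : IsGeodesicSeg x y γ) {f : X → X}
    (hf : Isometry f) : IsGeodesicSeg (f x) (f y) (fun t => f (γ t)) := by
  refine ⟨congrArg f h.1, congrArg f h.2.1, fun s hs t ht => ?_⟩
  rw [hf.dist_eq, hf.dist_eq, h.2.2 s hs t ht]

theorem dist_left {x y : X} {γ : ℝ → X} (h : IsGeodesicSeg x y γ) {t : ℝ}
    (ht : t ∈ Icc (0 : ℝ) 1) : dist (γ t) x = t * dist x y := by
  have := h.2.2 t ht 0 ⟨le_rfl, zero_le_one⟩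
  rwa [h.1, sub_zero, abs_of_nonneg ht.1] at this

variable [CAT0Space X]

/-- Two geodesics issuing from the same point diverge at least linearly. -/
theorem dist_le_of_common_left {p x y : X} {γ δ : ℝ → X} (hγ : IsGeodesicSeg p x γ)
    (hδ : IsGeodesicSeg p y δ) {t : ℝ} (ht : t ∈ Icc (0 : ℝ) 1) :
    dist (γ t) (δ t) ≤ t * dist x y := by
  have h1 := CAT0Space.comparison (γ t) p y δ hδ t ht
  have h2 := CAT0Space.comparison y p x γ hγ t ht
  rw [hγ.dist_left ht, dist_comm (γ t) y] at h1
  rw [dist_comm y p, dist_comm y x] at h2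
  refine le_of_sq_le_sq ?_ (mul_nonneg ht.1 dist_nonneg)
  nlinarith [mul_le_mul_of_nonneg_left h2 ht.1]

theorem dist_le {x y x' y' : X} {γ δ : ℝ → X} (hγ : IsGeodesicSeg x y γ)
    (hδ : IsGeodesicSeg x' y' δ) {t : ℝ} (ht : t ∈ Icc (0 : ℝ) 1) :
    dist (γ t) (δ t) ≤ (1 - t) * dist x x' + t * dist y y' := by
  obtain ⟨ε, hε⟩ := CAT0Space.exists_geodesic x y'
  have h1 := hγ.dist_le_of_common_left hε ht
  have h2 := hε.reverse.dist_le_of_common_left hδ.reverse (t := 1 - t)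
    ⟨by linarith [ht.2], by linarith [ht.1]⟩
  simp only [sub_sub_cancel] at h2
  linarith [dist_triangle (γ t) (ε t) (δ t)]

end IsGeodesicSeg

section Projection

variable [MetricSpace X] [CAT0Space X]

/-- In a quadrilateral of a CAT(0) space, the sum of the squares of the diagonals is at most the
sum of the squares of the sides. -/
theorem CAT0Space.quadrilateral (p q y x : X) :
    dist p y ^ 2 + dist q x ^ 2 ≤
      dist p q ^ 2 + dist q y ^ 2 + dist x y ^ 2 + dist p x ^ 2 := by
  obtain ⟨γ, hγ⟩ := CAT0Space.exists_geodesic p y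
  have h1 := CAT0Space.comparison q p y γ hγ (1 / 2) ⟨by norm_num, by norm_num⟩
  have h2 := CAT0Space.comparison x p y γ hγ (1 / 2) ⟨by norm_num, by norm_num⟩
  have h3 := dist_triangle_right q x (γ (1 / 2))
  rw [dist_comm q p] at h1
  rw [dist_comm x p] at h2
  have h4 : dist q x ^ 2 ≤ (dist q (γ (1 / 2)) + dist x (γ (1 / 2))) ^ 2 := by gcongr
  nlinarith [sq_nonneg (dist q (γ (1 / 2)) - dist x (γ (1 / 2)))]

/-- The obtuse angle property of nearest points in convex sets. -/
theorem GeoConvex.sq_dist_add_sq_dist_le {C : Set X} (hC : GeoConvex C) {p x z : X} (hx : x ∈ C)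
    (hz : z ∈ C) (hmin : ∀ w ∈ C, dist p x ≤ dist p w) :
    dist p x ^ 2 + dist x z ^ 2 ≤ dist p z ^ 2 := by
  obtain ⟨γ, hγ⟩ := CAT0Space.exists_geodesic x z
  have key : ∀ t ∈ Ioc (0 : ℝ) 1,
      dist p x ^ 2 + (1 - t) * dist x z ^ 2 ≤ dist p z ^ 2 := by
    intro t ht
    have ht' : t ∈ Icc (0 : ℝ) 1 := ⟨ht.1.le, ht.2⟩
    have h1 := CAT0Space.comparison p x z γ hγ t ht'
    have h2 : dist p x ^ 2 ≤ dist p (γ t) ^ 2 := by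
      gcongr
      exact hmin _ (hC x hx z hz γ hγ t ht')
    refine le_of_mul_le_mul_left ?_ ht.1
    linarith
  have hlim : Tendsto (fun t : ℝ => dist p x ^ 2 + (1 - t) * dist x z ^ 2) (nhdsWithin 0 (Ioi 0))
      (nhds (dist p x ^ 2 + (1 - 0) * dist x z ^ 2)) :=
    ((by fun_prop : Continuous fun t : ℝ => dist p x ^ 2 + (1 - t) * dist x z ^ 2).tendsto
      0).mono_left nhdsWithin_le_nhds
  have := le_of_tendsto hlim
    (Filter.eventually_of_mem (Ioc_mem_nhdsGT (zero_lt_one' ℝ)) key)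
  simpa using this

/-- Nearest-point projection to a convex set does not increase distances. -/
theorem GeoConvex.dist_nearest_le {C : Set X} (hC : GeoConvex C) {p q x y : X} (hx : x ∈ C)
    (hy : y ∈ C) (hpx : ∀ w ∈ C, dist p x ≤ dist p w) (hqy : ∀ w ∈ C, dist q y ≤ dist q w) :
    dist x y ≤ dist p q := by
  have h1 := hC.sq_dist_add_sq_dist_le hx hy hpx
  have h2 := hC.sq_dist_add_sq_dist_le hy hx hqy
  have h3 := CAT0Space.quadrilateral p q y x
  rw [dist_comm y x] at h2
  exact le_of_sq_le_sq (by linarith) dist_nonneg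

end Projection

section FixedPoint

variable [MetricSpace X] [ProperSpace X] [CAT0Space X]

/-- A sequence going to infinity subconverges, along geodesics from a base point, to a geodesic ray;
any isometry moving the sequence a bounded distance then moves the ray a bounded distance. -/
theorem exists_ray_of_tendsto_atTop (p : X) (y : ℕ → X)
    (hy : Tendsto (fun n => dist p (y n)) atTop atTop) :
    ∃ ρ : GeodesicRay X, ∀ (f : X → X) (hf : Isometry f) (C : ℝ),
      (∀ n, dist (f (y n)) (y n) ≤ C) → (ρ.comp f hf).Asymp ρ := by
  choose γ hγ using fun n => CAT0Space.exists_geodesic p (y n)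
  have hU : Tendsto (fun n => dist p (y n)) (hyperfilter ℕ) atTop :=
    hy.mono_left Nat.hyperfilter_le_atTop
  have hmem : ∀ t : ℝ, 0 ≤ t → ∀ᶠ n in (hyperfilter ℕ : Filter ℕ),
      0 < dist p (y n) ∧ t / dist p (y n) ∈ Icc (0 : ℝ) 1 := by
    intro t ht
    filter_upwards [hU.eventually_ge_atTop t, hU.eventually_gt_atTop 0] with n h1 h2
    exact ⟨h2, by positivity, (div_le_one h2).2 h1⟩
  have hex : ∀ t : ℝ, ∃ z, 0 ≤ t →
      Tendsto (fun n => γ n (t / dist p (y n))) (hyperfilter ℕ) (nhds z) := by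
    intro t
    by_cases ht : 0 ≤ t
    · obtain ⟨z, -, hz⟩ := (isCompact_closedBall p t).ultrafilter_le_nhds'
        ((hyperfilter ℕ).map fun n => γ n (t / dist p (y n))) (by
          rw [Ultrafilter.mem_map]
          filter_upwards [hmem t ht] with n hn
          rw [mem_preimage, mem_closedBall, (hγ n).dist_left hn.2, div_mul_cancel₀ _ hn.1.ne'])
      exact ⟨z, fun _ => hz⟩
    · exact ⟨p, fun h => absurd h ht⟩
  choose r hr using hex
  refine ⟨⟨r, fun s hs t ht => ?_⟩, fun f hf C hC => ⟨dist (f p) p + C, fun t ht => ?_⟩⟩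
  · refine tendsto_nhds_unique ((hr s hs).dist (hr t ht)) (tendsto_const_nhds.congr' ?_)
    filter_upwards [hmem s hs, hmem t ht] with n h1 h2
    rw [(hγ n).2.2 _ h1.2 _ h2.2, ← sub_div, abs_div, abs_of_pos h1.1, div_mul_cancel₀ _ h1.1.ne']
  · refine le_of_tendsto (((hf.continuous.tendsto _).comp (hr t ht)).dist (hr t ht)) ?_
    filter_upwards [hmem t ht] with n hn
    have h := ((hγ n).comp_isometry hf).dist_le (hγ n) hn.2
    have h1 := hn.2.1
    have h2 := hn.2.2
    have h3 : dist (f p) p * (1 - t / dist p (y n)) ≤ dist (f p) p :=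
      mul_le_of_le_one_right dist_nonneg (by linarith)
    have h4 : dist (f (y n)) (y n) * (t / dist p (y n)) ≤ dist (f (y n)) (y n) :=
      mul_le_of_le_one_right dist_nonneg h2
    simp only [Function.comp_apply]
    linarith [hC n]

end FixedPoint

/-- either a global fixed point at infinity, or every filtering family of
nonempty closed convex invariant subsets has nonempty intersection. -/
theorem stmt11 (X : Type u) [MetricSpace X] [ProperSpace X] [CAT0Space X]
    (G : Type v) [Group G] [MulAction G X]
    (hiso : ∀ g : G, Isometry (fun x : X => g • x)) :
    (∃ ξ : Boundary X, ∀ g : G, Boundary.map (fun x : X => g • x) (hiso g) ξ = ξ) ∨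
    ∀ 𝒴 : Set (Set X), 𝒴.Nonempty →
      (∀ Y ∈ 𝒴, Y.Nonempty ∧ IsClosed Y ∧ GeoConvex Y ∧ ∀ g : G, ∀ x ∈ Y, g • x ∈ Y) →
      (∀ Y ∈ 𝒴, ∀ Z ∈ 𝒴, ∃ W ∈ 𝒴, W ⊆ Y ∩ Z) →
      (⋂₀ 𝒴).Nonempty := by
  refine or_iff_not_imp_right.2 fun hne => ?_
  push Not at hne
  obtain ⟨𝒴, ⟨Y₀, hY₀⟩, hY, hdir, hempty⟩ := hne
  obtain ⟨p, -⟩ := (hY Y₀ hY₀).1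
  have hunb : ∀ R : ℝ, ∃ Y ∈ 𝒴, ∀ y ∈ Y, R < dist p y := by
    by_contra! hb
    obtain ⟨R, hR⟩ := hb
    have : Nonempty 𝒴 := ⟨⟨Y₀, hY₀⟩⟩
    obtain ⟨z, hz⟩ := IsCompact.nonempty_iInter_of_directed_nonempty_isCompact_isClosed
      (fun Y : 𝒴 => (Y : Set X) ∩ closedBall p R)
      (by
        rintro ⟨Y, hY'⟩ ⟨Z, hZ'⟩
        obtain ⟨W, hW, hWYZ⟩ := hdir Y hY' Z hZ'
        exact ⟨⟨W, hW⟩, inter_subset_inter_left _ fun x hx => (hWYZ hx).1,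
          inter_subset_inter_left _ fun x hx => (hWYZ hx).2⟩)
      (by
        rintro ⟨Y, hY'⟩
        obtain ⟨y, hy, hyR⟩ := hR Y hY'
        exact ⟨y, hy, by rwa [mem_closedBall, dist_comm]⟩)
      (fun Y => (isCompact_closedBall p R).inter_left (hY Y Y.2).2.1)
      (fun Y => (hY Y Y.2).2.1.inter isClosed_closedBall)
    rw [mem_iInter] at hz
    have hz' : z ∈ ⋂₀ 𝒴 := fun Y hY' => (hz ⟨Y, hY'⟩).1
    simp [hempty] at hz'
  choose Y hYmem hYfar using fun n : ℕ => hunb n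
  have hproj : ∀ n, ∃ y ∈ Y n, ∀ w ∈ Y n, dist p y ≤ dist p w := by
    intro n
    obtain ⟨y, hy, hd⟩ := (hY _ (hYmem n)).2.1.exists_infDist_eq_dist (hY _ (hYmem n)).1 p
    exact ⟨y, hy, fun w hw => hd ▸ infDist_le_dist_of_mem hw⟩
  choose y hymem hymin using hproj
  obtain ⟨ρ, hρ⟩ := exists_ray_of_tendsto_atTop p y
    (tendsto_atTop_mono (fun n => (hYfar n _ (hymem n)).le) tendsto_natCast_atTop_atTop)
  refine ⟨ρ.cls, fun g => Quotient.sound (hρ _ (hiso g) (dist (g • p) p) fun n => ?_)⟩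
  obtain ⟨-, -, hconv, hinv⟩ := hY _ (hYmem n)
  refine hconv.dist_nearest_le (hinv g _ (hymem n)) (hymem n) (fun w hw => ?_) (hymin n)
  have h := hymin n _ (hinv g⁻¹ w hw)
  rw [← (hiso g).dist_eq p (g⁻¹ • w)] at h
  simpa [(hiso g).dist_eq] using h
end

section
/- Let X be a proper CAT(0) space and H ≤ Isom(X) a closed subgroup acting cocompactly on X. If H fixes a point ξ ∈ ∂X, then the set ξ^op of points of ∂X opposite ξ is nonempty and H acts transitively on ξ^op. -/
open Metric Set Filter

universe u v

variable {X : Type u}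

section GeodesicConvexity

variable [MetricSpace X]

theorem IsGeodesicSeg.reverse_s18 {x y : X} {γ : ℝ → X} (h : IsGeodesicSeg x y γ) :
    IsGeodesicSeg y x (fun t => γ (1 - t)) := by
  obtain ⟨h0, h1, hd⟩ := h
  refine ⟨by simpa using h1, by simpa using h0, fun s hs t ht => ?_⟩
  rw [hd (1 - s) ⟨by linarith [hs.2], by linarith [hs.1]⟩ (1 - t)
    ⟨by linarith [ht.2], by linarith [ht.1]⟩, dist_comm x y, abs_sub_comm s t]
  congr 2
  ring

theorem isGeodesicSeg_of_isometric_on_Icc {f : ℝ → X} {a b : ℝ} (hab : a ≤ b)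
    (hf : ∀ s ∈ Icc a b, ∀ t ∈ Icc a b, dist (f s) (f t) = |s - t|) :
    IsGeodesicSeg (f a) (f b) (fun θ => f (a + θ * (b - a))) := by
  have hmem : ∀ θ ∈ Icc (0 : ℝ) 1, a + θ * (b - a) ∈ Icc a b := fun θ hθ =>
    ⟨by nlinarith [hθ.1], by nlinarith [hθ.2]⟩
  refine ⟨by simp, by simp, fun s hs t ht => ?_⟩
  rw [hf _ (hmem s hs) _ (hmem t ht), hf a ⟨le_rfl, hab⟩ b ⟨hab, le_rfl⟩,
    abs_sub_comm a b, ← abs_mul]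
  congr 1
  ring

theorem IsGeodesicSeg.dist_le_of_common_source [CAT0Space X] {p x y : X} {γ δ : ℝ → X}
    (hγ : IsGeodesicSeg p x γ) (hδ : IsGeodesicSeg p y δ) {t : ℝ} (ht : t ∈ Icc (0 : ℝ) 1) :
    dist (γ t) (δ t) ≤ t * dist x y := by
  have h₁ := CAT0Space.comparison (γ t) p y δ hδ t ht
  have h₂ := CAT0Space.comparison y p x γ hγ t ht
  have h₃ : dist (γ t) p = t * dist p x := by
    have := hγ.2.2 t ht 0 ⟨le_rfl, zero_le_one⟩
    rwa [hγ.1, sub_zero, abs_of_nonneg ht.1] at this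
  rw [dist_comm y (γ t), dist_comm y p, dist_comm y x] at h₂
  rw [h₃] at h₁
  refine abs_le_of_sq_le_sq' ?_ (mul_nonneg ht.1 dist_nonneg) |>.2
  nlinarith [mul_le_mul_of_nonneg_left h₂ ht.1]

theorem IsGeodesicSeg.dist_le_s18 [CAT0Space X] {x y x' y' : X} {γ δ : ℝ → X}
    (hγ : IsGeodesicSeg x y γ) (hδ : IsGeodesicSeg x' y' δ) {t : ℝ} (ht : t ∈ Icc (0 : ℝ) 1) :
    dist (γ t) (δ t) ≤ (1 - t) * dist x x' + t * dist y y' := by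
  obtain ⟨ε, hε⟩ := CAT0Space.exists_geodesic x y'
  have h₁ := hγ.dist_le_of_common_source hε ht
  have h₂ := hε.reverse_s18.dist_le_of_common_source hδ.reverse_s18 (t := 1 - t)
    ⟨by linarith [ht.2], by linarith [ht.1]⟩
  simp only [sub_sub_cancel] at h₂
  linarith [dist_triangle (γ t) (ε t) (δ t)]

/-- The distance between two asymptotic geodesic rays is nonincreasing. -/
theorem dist_le_dist_of_asymptotic [CAT0Space X] {f g : ℝ → X} {a : ℝ}
    (hf : ∀ s, a ≤ s → ∀ t, a ≤ t → dist (f s) (f t) = |s - t|)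
    (hg : ∀ s, a ≤ s → ∀ t, a ≤ t → dist (g s) (g t) = |s - t|)
    {C : ℝ} (hC : ∀ t, 0 ≤ t → dist (f t) (g t) ≤ C) {t : ℝ} (hat : a ≤ t) :
    dist (f t) (g t) ≤ dist (f a) (g a) := by
  have hlim : Tendsto (fun T : ℝ => dist (f a) (g a) + (t - a) * C / (T - a)) atTop
      (nhds (dist (f a) (g a) + 0)) :=
    tendsto_const_nhds.add
      (tendsto_const_nhds.div_atTop (tendsto_atTop_add_const_right _ (-a) tendsto_id))
  rw [add_zero] at hlim
  refine ge_of_tendsto hlim ?_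
  filter_upwards [eventually_gt_atTop a, eventually_ge_atTop t, eventually_ge_atTop 0]
    with T haT htT hT
  have hpos : 0 < T - a := sub_pos.2 haT
  have hθ : (t - a) / (T - a) ∈ Icc (0 : ℝ) 1 :=
    ⟨div_nonneg (sub_nonneg.2 hat) hpos.le, (div_le_one hpos).2 (by linarith)⟩
  have key := (isGeodesicSeg_of_isometric_on_Icc haT.le
      fun s hs u hu => hf s hs.1 u hu.1).dist_le_s18
    (isGeodesicSeg_of_isometric_on_Icc haT.le fun s hs u hu => hg s hs.1 u hu.1) hθ
  have ht' : a + (t - a) / (T - a) * (T - a) = t := by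
    rw [div_mul_cancel₀ _ hpos.ne']; ring
  simp only [ht'] at key
  have h₁ := mul_le_mul_of_nonneg_left (hC T hT) hθ.1
  have h₂ := mul_nonneg hθ.1 (dist_nonneg (x := f a) (y := g a))
  rw [div_mul_eq_mul_div (t - a) (T - a) C] at h₁
  linarith

end GeodesicConvexity

theorem IsometryEquiv.tendsto_apply_of_tendsto [MetricSpace X] {ι : Type*} {l : Filter ι} {h : ι → X ≃ᵢ X}
    {g : X ≃ᵢ X} (hg : Tendsto h l (nhds g)) (x : X) :
    Tendsto (fun i => h i x) l (nhds (g x)) := by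
  rw [nhds_induced, tendsto_comap_iff] at hg
  exact ((ContinuousEvalConst.continuous_eval_const (F := C(X, X)) x).tendsto _).comp hg

section UltrafilterLimits

variable [MetricSpace X] [ProperSpace X]

theorem Ultrafilter.exists_tendsto_of_eventually_dist_le {ι : Type*} (U : Ultrafilter ι)
    {u : ι → X} {p : X} {C : ℝ} (h : ∀ᶠ i in (U : Filter ι), dist (u i) p ≤ C) :
    ∃ z, Tendsto u U (nhds z) := by
  obtain ⟨z, -, hz⟩ := (isCompact_closedBall p C).ultrafilter_le_nhds (U.map u)
    (le_principal_iff.2 h)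
  exact ⟨z, hz⟩

/-- Isometries moving a given point by a bounded amount converge along any ultrafilter. -/
theorem Ultrafilter.exists_tendsto_isometryEquiv {ι : Type*} (U : Ultrafilter ι)
    (h : ι → X ≃ᵢ X) {p q : X} {C : ℝ} (hC : ∀ i, dist (h i p) q ≤ C) :
    ∃ g : X ≃ᵢ X, Tendsto h U (nhds g) := by
  have hfwd : ∀ y, ∃ z, Tendsto (fun i => h i y) U (nhds z) := fun y =>
    U.exists_tendsto_of_eventually_dist_le (p := q) (C := dist y p + C) <| .of_forall fun i => by
      have := dist_triangle (h i y) (h i p) q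
      rw [(h i).dist_eq] at this
      linarith [hC i]
  have hbwd : ∀ y, ∃ z, Tendsto (fun i => (h i).symm y) U (nhds z) := fun y =>
    U.exists_tendsto_of_eventually_dist_le (p := p) (C := dist y q + C) <| .of_forall fun i => by
      rw [← (h i).dist_eq, (h i).apply_symm_apply]
      linarith [dist_triangle_right y (h i p) q, hC i]
  choose f hf using hfwd
  choose k hk using hbwd
  have hiso : Isometry f := Isometry.of_dist_eq fun x y =>
    tendsto_nhds_unique ((hf x).dist (hf y))
      (tendsto_const_nhds.congr fun i => ((h i).dist_eq x y).symm)
  have hfk : ∀ y, f (k y) = y := fun y => by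
    have h₁ : Tendsto (fun i => dist (h i (k y)) y) U (nhds (dist (f (k y)) y)) :=
      (hf (k y)).dist tendsto_const_nhds
    have h₂ : Tendsto (fun i => dist (h i (k y)) y) U (nhds 0) := by
      have := (tendsto_const_nhds (x := k y)).dist (hk y)
      rw [dist_self] at this
      refine this.congr fun i => ?_
      rw [← (h i).dist_eq, (h i).apply_symm_apply]
    exact dist_eq_zero.1 (tendsto_nhds_unique h₁ h₂)
  refine ⟨IsometryEquiv.mk' f k hfk hiso, ?_⟩
  rw [nhds_induced, tendsto_comap_iff, ContinuousMap.tendsto_iff_tendstoLocallyUniformly,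
    Metric.tendstoLocallyUniformly_iff]
  intro ε hε x
  refine ⟨ball x (ε / 3), ball_mem_nhds x (by positivity), ?_⟩
  filter_upwards [Metric.tendsto_nhds.1 (hf x) (ε / 3) (by positivity)] with i hi y hy
  change dist (f y) (h i y) < ε
  have h₁ : dist (f y) (f x) < ε / 3 := by rw [hiso.dist_eq]; exact hy
  have h₂ : dist (h i y) (h i x) < ε / 3 := by rw [(h i).dist_eq]; exact hy
  have h₃ := dist_triangle4 (f y) (f x) (h i x) (h i y)
  rw [dist_comm (f x), dist_comm (h i x) (h i y)] at h₃
  linarith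

end UltrafilterLimits

section CocompactStabilizer

variable [MetricSpace X] [ProperSpace X] [CAT0Space X]

theorem exists_oppositeBd_of_cocompact (H : Subgroup (X ≃ᵢ X))
    (hcocompact : ∃ (x : X) (r : ℝ), ∀ y : X, ∃ h ∈ H, h y ∈ Metric.closedBall x r)
    (ξ : Boundary X) (hfix : ∀ h ∈ H, Boundary.map (⇑h) h.isometry ξ = ξ) :
    ∃ η, OppositeBd ξ η := by
  obtain ⟨x, r, hr⟩ := hcocompact
  obtain ⟨ρ, rfl⟩ := Quotient.exists_rep ξ
  choose h hH hball using fun n : ℕ => hr (ρ.toFun n)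
  have hasymp : ∀ n, (ρ.comp (h n) (h n).isometry).Asymp ρ := fun n =>
    Quotient.exact (hfix (h n) (hH n))
  let U : Ultrafilter ℕ := Ultrafilter.of atTop
  have hU : (U : Filter ℕ) ≤ atTop := Ultrafilter.of_le atTop
  have hlarge : ∀ s : ℝ, ∀ᶠ n : ℕ in (U : Filter ℕ), 0 ≤ n + s := fun s =>
    ((tendsto_natCast_atTop_atTop (R := ℝ)).eventually_ge_atTop (-s)).filter_mono hU |>.mono
      fun n hn => by linarith
  have hlim : ∀ s : ℝ, ∃ z, Tendsto (fun n : ℕ => h n (ρ.toFun (n + s))) U (nhds z) := fun s =>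
    U.exists_tendsto_of_eventually_dist_le (p := x) (C := |s| + r) <|
      (hlarge s).mono fun n hn => by
        have h₁ := dist_triangle (h n (ρ.toFun (n + s))) (h n (ρ.toFun n)) x
        rw [(h n).dist_eq, ρ.isom _ hn _ n.cast_nonneg, add_sub_cancel_left] at h₁
        linarith [mem_closedBall.1 (hball n)]
  choose ℓ hℓ using hlim
  have hline : ∀ s t, dist (ℓ s) (ℓ t) = |s - t| := fun s t =>
    tendsto_nhds_unique ((hℓ s).dist (hℓ t)) <| tendsto_const_nhds.congr' <| by
      filter_upwards [hlarge s, hlarge t] with n hs ht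
      rw [(h n).dist_eq, ρ.isom _ hs _ ht, add_sub_add_left_eq_sub]
  refine ⟨_, fun s => ℓ (-s), fun s t => ?_, ?_, rfl⟩
  · rw [hline, abs_sub_comm s t]
    congr 1
    ring
  refine Quotient.sound ⟨r + dist x (ρ.toFun 0), fun t ht => ?_⟩
  simp only [GeodesicRay.ofLineBwd, neg_neg]
  refine le_of_tendsto ((hℓ t).dist tendsto_const_nhds) (.of_forall fun n => ?_)
  obtain ⟨C, hC⟩ := hasymp n
  have hn : (0 : ℝ) ≤ n := n.cast_nonneg
  have key := dist_le_dist_of_asymptotic (a := 0) (f := fun t => h n (ρ.toFun (n + t)))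
    (g := ρ.toFun) (C := n + C)
    (fun s hs u hu => by
      rw [(h n).dist_eq, ρ.isom _ (by linarith) _ (by linarith), add_sub_add_left_eq_sub])
    ρ.isom (fun u hu => by
      have h₁ := dist_triangle (h n (ρ.toFun (n + u))) (h n (ρ.toFun u)) (ρ.toFun u)
      rw [(h n).dist_eq, ρ.isom _ (by linarith) _ hu, add_sub_cancel_right,
        abs_of_nonneg hn] at h₁
      have h₂ : dist (h n (ρ.toFun u)) (ρ.toFun u) ≤ C := hC u hu
      linarith) ht
  simp only [add_zero] at key
  linarith [dist_triangle (h n (ρ.toFun n)) x (ρ.toFun 0), mem_closedBall.1 (hball n)]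

theorem exists_map_eq_of_oppositeBd (H : Subgroup (X ≃ᵢ X))
    (hHclosed : IsClosed (H : Set (X ≃ᵢ X)))
    (hcocompact : ∃ (x : X) (r : ℝ), ∀ y : X, ∃ h ∈ H, h y ∈ Metric.closedBall x r)
    {ξ η₁ η₂ : Boundary X} (hfix : ∀ h ∈ H, Boundary.map (⇑h) h.isometry ξ = ξ)
    (h₁ : OppositeBd ξ η₁) (h₂ : OppositeBd ξ η₂) :
    ∃ h ∈ H, Boundary.map (⇑h) h.isometry η₁ = η₂ := by
  obtain ⟨x, r, hr⟩ := hcocompact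
  obtain ⟨ℓ₁, hℓ₁, hξ₁, rfl⟩ := h₁
  obtain ⟨ℓ₂, hℓ₂, hξ₂, rfl⟩ := h₂
  have hmove : ∀ y z : X, ∃ h ∈ H, dist (h y) z ≤ 2 * r := fun y z => by
    obtain ⟨a, ha, hay⟩ := hr y
    obtain ⟨b, hb, hbz⟩ := hr z
    refine ⟨b⁻¹ * a, H.mul_mem (H.inv_mem hb) ha, ?_⟩
    rw [IsometryEquiv.mul_apply, ← b.dist_eq, IsometryEquiv.apply_inv_self]
    linarith [dist_triangle_right (a y) (b z) x, mem_closedBall.1 hay, mem_closedBall.1 hbz]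
  choose h hH hclose using fun n : ℕ => hmove (ℓ₁ n) (ℓ₂ n)
  have hbound : ∀ (n : ℕ) (s : ℝ), s ≤ n → dist (h n (ℓ₁ s)) (ℓ₂ s) ≤ 2 * r := by
    intro n s hs
    obtain ⟨C, hC⟩ : ((GeodesicRay.ofLineBwd ℓ₁ hℓ₁).comp (h n) (h n).isometry).Asymp
        (GeodesicRay.ofLineBwd ℓ₂ hℓ₂) := by
      have := hfix (h n) (hH n)
      nth_rewrite 1 [← hξ₁] at this
      exact Quotient.exact (this.trans hξ₂.symm)
    have key := dist_le_dist_of_asymptotic (a := -n) (t := -s) (C := C)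
      (f := fun t => h n (ℓ₁ (-t))) (g := fun t => ℓ₂ (-t))
      (fun u _ v _ => by rw [(h n).dist_eq, hℓ₁, abs_sub_comm u v]; congr 1; ring)
      (fun u _ v _ => by rw [hℓ₂, abs_sub_comm u v]; congr 1; ring)
      hC (neg_le_neg hs)
    simp only [neg_neg] at key
    exact key.trans (hclose n)
  let U : Ultrafilter ℕ := Ultrafilter.of atTop
  have hU : (U : Filter ℕ) ≤ atTop := Ultrafilter.of_le atTop
  obtain ⟨g, hg⟩ := U.exists_tendsto_isometryEquiv h fun n => hbound n 0 n.cast_nonneg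
  refine ⟨g, hHclosed.mem_of_tendsto hg (.of_forall hH),
    Quotient.sound ⟨2 * r, fun t _ => ?_⟩⟩
  refine le_of_tendsto
    ((IsometryEquiv.tendsto_apply_of_tendsto hg (ℓ₁ t)).dist tendsto_const_nhds) ?_
  exact (((tendsto_natCast_atTop_atTop (R := ℝ)).eventually_ge_atTop t).filter_mono hU).mono
    fun n hn => hbound n t hn

end CocompactStabilizer

/-- a cocompact closed subgroup of the isometry group fixing `ξ ∈ ∂X`
acts transitively on the nonempty set of points opposite `ξ`. -/
theorem stmt18 (X : Type u) [MetricSpace X] [ProperSpace X] [CAT0Space X]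
    (H : Subgroup (X ≃ᵢ X)) (hHclosed : IsClosed (H : Set (X ≃ᵢ X)))
    (hcocompact : ∃ (x : X) (r : ℝ), ∀ y : X, ∃ h ∈ H, h y ∈ Metric.closedBall x r)
    (ξ : Boundary X) (hfix : ∀ h ∈ H, Boundary.map (⇑h) h.isometry ξ = ξ) :
    {η : Boundary X | OppositeBd ξ η}.Nonempty ∧
    ∀ η₁ ∈ {η : Boundary X | OppositeBd ξ η}, ∀ η₂ ∈ {η : Boundary X | OppositeBd ξ η},
      ∃ h ∈ H, Boundary.map (⇑h) h.isometry η₁ = η₂ := by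
  exact ⟨exists_oppositeBd_of_cocompact H hcocompact ξ hfix, fun _ h₁ _ h₂ =>
    exists_map_eq_of_oppositeBd H hHclosed hcocompact hfix h₁ h₂⟩
end
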